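/- Let μ be the pre-Lie multiplication on ℂ² given by e1·e1 = e2 (algebra C03), and let ν be any bilinear map on ℂ² such that (ℂ², μ, ν) is a compatible pre-Lie algebra. Then (ℂ², μ, ν) is isomorphic as a compatible pre-Lie algebra to one of the following algebras, each with first multiplication μ and second multiplication ∗ as listed (α ∈ ℂ): C13^α: e1∗e1 = α e1, e1∗e2 = e2, e2∗e1 = α e2; C14^α: e1∗e1 = e1 + α e2, e2∗e1 = e2; C15^α: e1∗e1 = α e2; C16^α: e1∗e1 = e1, e1∗e2 = α e2; C17^α: e1∗e1 = e1 + α e2, e1∗e2 = e2; C18^α: e1∗e1 = α e2, e1∗e2 = e1, e2∗e1 = e1, e2∗e2 = e2; C19^α: e1∗e1 = α e2, e2∗e1 = e1, e2∗e2 = 2 e2. -/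

import Mathlib

open scoped BigOperators

/-- The underlying vector space `ℂ²`. -/
abbrev V2 : Type := Fin 2 → ℂ

/-- The first standard basis vector of `ℂ²`. -/
noncomputable def e1 : V2 := ![1, 0]

/-- The second standard basis vector of `ℂ²`. -/
noncomputable def e2 : V2 := ![0, 1]

/-- The bilinear multiplication on `ℂ²` with multiplication table `f`,
i.e. the product of the `i`-th and `j`-th basis vectors is `f i j`. -/
noncomputable def bil (f : Fin 2 → Fin 2 → V2) : V2 →ₗ[ℂ] V2 →ₗ[ℂ] V2 :=
  LinearMap.mk₂ ℂ (fun x y => ∑ i : Fin 2, ∑ j : Fin 2, (x i * y j) • f i j)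
    (fun x x' y => by
      simp only [Pi.add_apply, add_mul, add_smul, Finset.sum_add_distrib])
    (fun c x y => by
      simp only [Pi.smul_apply, smul_eq_mul, Finset.smul_sum, smul_smul]
      refine Finset.sum_congr rfl fun i _ => Finset.sum_congr rfl fun j _ => ?_
      congr 1
      ring)
    (fun x y y' => by
      simp only [Pi.add_apply, mul_add, add_smul, Finset.sum_add_distrib])
    (fun c x y => by
      simp only [Pi.smul_apply, smul_eq_mul, Finset.smul_sum, smul_smul]
      refine Finset.sum_congr rfl fun i _ => Finset.sum_congr rfl fun j _ => ?_
      congr 1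
      ring)

/-- A bilinear map is a pre-Lie multiplication if it satisfies the (right)
pre-Lie identity. -/
def IsPreLie {V : Type*} [AddCommGroup V] [Module ℂ V]
    (μ : V →ₗ[ℂ] V →ₗ[ℂ] V) : Prop :=
  ∀ x y z : V, μ (μ x y) z - μ x (μ y z) = μ (μ y x) z - μ y (μ x z)

/-- `(V, μ, ν)` is a compatible pre-Lie algebra: `μ`, `ν` and `μ + ν` are all
pre-Lie multiplications. -/
def IsCompatPreLie {V : Type*} [AddCommGroup V] [Module ℂ V]
    (μ ν : V →ₗ[ℂ] V →ₗ[ℂ] V) : Prop :=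
  IsPreLie μ ∧ IsPreLie ν ∧ IsPreLie (μ + ν)

/-- Isomorphism of the two-multiplication algebras `(ℂ², μ, ν)` and `(ℂ², μ', ν')`. -/
def CompatIso (μ ν μ' ν' : V2 →ₗ[ℂ] V2 →ₗ[ℂ] V2) : Prop :=
  ∃ φ : V2 ≃ₗ[ℂ] V2, (∀ x y : V2, φ (μ x y) = μ' (φ x) (φ y)) ∧
    (∀ x y : V2, φ (ν x y) = ν' (φ x) (φ y))

/-- `C01 : e1·e1 = e1 + e2, e2·e1 = e2`. -/
noncomputable def C01 : V2 →ₗ[ℂ] V2 →ₗ[ℂ] V2 := bil ![![e1 + e2, 0], ![e2, 0]]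

/-- `C02 : e1·e1 = e1 + e2, e1·e2 = e2`. -/
noncomputable def C02 : V2 →ₗ[ℂ] V2 →ₗ[ℂ] V2 := bil ![![e1 + e2, e2], ![0, 0]]

/-- `C03 : e1·e1 = e2`. -/
noncomputable def C03 : V2 →ₗ[ℂ] V2 →ₗ[ℂ] V2 := bil ![![e2, 0], ![0, 0]]

/-- `C04 : e2·e1 = e1`. -/
noncomputable def C04 : V2 →ₗ[ℂ] V2 →ₗ[ℂ] V2 := bil ![![0, 0], ![e1, 0]]

/-- `C05^α : e1·e1 = e1, e1·e2 = α e2`. -/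
noncomputable def C05 (α : ℂ) : V2 →ₗ[ℂ] V2 →ₗ[ℂ] V2 := bil ![![e1, α • e2], ![0, 0]]

/-- `C06^α : e1·e1 = e1, e1·e2 = α e2, e2·e1 = e2`. -/
noncomputable def C06 (α : ℂ) : V2 →ₗ[ℂ] V2 →ₗ[ℂ] V2 := bil ![![e1, α • e2], ![e2, 0]]

/-- `C07 : e1·e1 = e1, e2·e2 = e2`. -/
noncomputable def C07 : V2 →ₗ[ℂ] V2 →ₗ[ℂ] V2 := bil ![![e1, 0], ![0, e2]]

/-- `C08 : e1·e1 = e1, e1·e2 = 2 e2, e2·e1 = (1/2) e1 + e2, e2·e2 = e2`. -/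
noncomputable def C08 : V2 →ₗ[ℂ] V2 →ₗ[ℂ] V2 :=
  bil ![![e1, (2 : ℂ) • e2], ![(1 / 2 : ℂ) • e1 + e2, e2]]

/-- The second multiplication of `C09^{α,β}`: `e1∗e1 = α e1, e1∗e2 = β e2, e2∗e1 = α e2`. -/
noncomputable def C09s (α β : ℂ) : V2 →ₗ[ℂ] V2 →ₗ[ℂ] V2 :=
  bil ![![α • e1, β • e2], ![α • e2, 0]]

/-- The second multiplication of `C10^{α,β}`: `e1∗e1 = α e1 + β e2, e2∗e1 = α e2`. -/
noncomputable def C10s (α β : ℂ) : V2 →ₗ[ℂ] V2 →ₗ[ℂ] V2 :=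
  bil ![![α • e1 + β • e2, 0], ![α • e2, 0]]

/-- The second multiplication of `C11^{α,β}`: `e1∗e1 = α e1, e1∗e2 = β e2`. -/
noncomputable def C11s (α β : ℂ) : V2 →ₗ[ℂ] V2 →ₗ[ℂ] V2 :=
  bil ![![α • e1, β • e2], ![0, 0]]

/-- The second multiplication of `C12^{α,β}`: `e1∗e1 = α e1 + β e2, e1∗e2 = α e2`. -/
noncomputable def C12s (α β : ℂ) : V2 →ₗ[ℂ] V2 →ₗ[ℂ] V2 :=
  bil ![![α • e1 + β • e2, α • e2], ![0, 0]]

/-- The second multiplication of `C13^α`: `e1∗e1 = α e1, e1∗e2 = e2, e2∗e1 = α e2`. -/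
noncomputable def C13s (α : ℂ) : V2 →ₗ[ℂ] V2 →ₗ[ℂ] V2 :=
  bil ![![α • e1, e2], ![α • e2, 0]]

/-- The second multiplication of `C14^α`: `e1∗e1 = e1 + α e2, e2∗e1 = e2`. -/
noncomputable def C14s (α : ℂ) : V2 →ₗ[ℂ] V2 →ₗ[ℂ] V2 :=
  bil ![![e1 + α • e2, 0], ![e2, 0]]

/-- The second multiplication of `C15^α`: `e1∗e1 = α e2`. -/
noncomputable def C15s (α : ℂ) : V2 →ₗ[ℂ] V2 →ₗ[ℂ] V2 :=
  bil ![![α • e2, 0], ![0, 0]]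

/-- The second multiplication of `C16^α`: `e1∗e1 = e1, e1∗e2 = α e2`. -/
noncomputable def C16s (α : ℂ) : V2 →ₗ[ℂ] V2 →ₗ[ℂ] V2 :=
  bil ![![e1, α • e2], ![0, 0]]

/-- The second multiplication of `C17^α`: `e1∗e1 = e1 + α e2, e1∗e2 = e2`. -/
noncomputable def C17s (α : ℂ) : V2 →ₗ[ℂ] V2 →ₗ[ℂ] V2 :=
  bil ![![e1 + α • e2, e2], ![0, 0]]

/-- The second multiplication of `C18^α`: `e1∗e1 = α e2, e1∗e2 = e1, e2∗e1 = e1, e2∗e2 = e2`. -/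
noncomputable def C18s (α : ℂ) : V2 →ₗ[ℂ] V2 →ₗ[ℂ] V2 :=
  bil ![![α • e2, e1], ![e1, e2]]

/-- The second multiplication of `C19^α`: `e1∗e1 = α e2, e2∗e1 = e1, e2∗e2 = 2 e2`. -/
noncomputable def C19s (α : ℂ) : V2 →ₗ[ℂ] V2 →ₗ[ℂ] V2 :=
  bil ![![α • e2, 0], ![e1, (2 : ℂ) • e2]]

/-- The second multiplication of `C20^{α,β}`: `e2∗e1 = α e1, e2∗e2 = e1 + β e2`. -/
noncomputable def C20s (α β : ℂ) : V2 →ₗ[ℂ] V2 →ₗ[ℂ] V2 :=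
  bil ![![0, 0], ![α • e1, e1 + β • e2]]

/-- The second multiplication of `C21^{α,β}`: `e2∗e1 = α e1, e2∗e2 = β e2`. -/
noncomputable def C21s (α β : ℂ) : V2 →ₗ[ℂ] V2 →ₗ[ℂ] V2 :=
  bil ![![0, 0], ![α • e1, β • e2]]

/-- The second multiplication of `C22^{α,β}`: `e1∗e2 = α e1, e2∗e1 = β e1, e2∗e2 = e1 + α e2`. -/
noncomputable def C22s (α β : ℂ) : V2 →ₗ[ℂ] V2 →ₗ[ℂ] V2 :=
  bil ![![0, α • e1], ![β • e1, e1 + α • e2]]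

/-- The second multiplication of `C23^{α,β}`: `e1∗e2 = α e1, e2∗e1 = β e1, e2∗e2 = α e2`. -/
noncomputable def C23s (α β : ℂ) : V2 →ₗ[ℂ] V2 →ₗ[ℂ] V2 :=
  bil ![![0, α • e1], ![β • e1, α • e2]]

/-- The second multiplication of `C24^{α,β,γ}`: `e1∗e1 = β e1 + e2, e1∗e2 = γ e2`. -/
noncomputable def C24s (β γ : ℂ) : V2 →ₗ[ℂ] V2 →ₗ[ℂ] V2 :=
  bil ![![β • e1 + e2, γ • e2], ![0, 0]]

/-- The second multiplication of `C25^{α,β,γ}`: `e1∗e1 = β e1, e1∗e2 = γ e2`. -/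
noncomputable def C25s (β γ : ℂ) : V2 →ₗ[ℂ] V2 →ₗ[ℂ] V2 :=
  bil ![![β • e1, γ • e2], ![0, 0]]

/-- The second multiplication of `C29^α`: `e1∗e1 = α e1, e2∗e2 = e2`. -/
noncomputable def C29s (α : ℂ) : V2 →ₗ[ℂ] V2 →ₗ[ℂ] V2 :=
  bil ![![α • e1, 0], ![0, e2]]

/-- The second multiplication of `C30^{α,β}`:
`e1∗e1 = α e1 + β e2, e1∗e2 = e1, e2∗e1 = e1, e2∗e2 = e2`. -/
noncomputable def C30s (α β : ℂ) : V2 →ₗ[ℂ] V2 →ₗ[ℂ] V2 :=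
  bil ![![α • e1 + β • e2, e1], ![e1, e2]]

/-- The second multiplication of `C31^{α,β,γ}`:
`e1∗e1 = β e1 + e2, e1∗e2 = γ e2, e2∗e1 = β e2`. -/
noncomputable def C31s (β γ : ℂ) : V2 →ₗ[ℂ] V2 →ₗ[ℂ] V2 :=
  bil ![![β • e1 + e2, γ • e2], ![β • e2, 0]]

/-- The second multiplication of `C32^{α,β,γ}`:
`e1∗e1 = β e1, e1∗e2 = γ e2, e2∗e1 = β e2`. -/
noncomputable def C32s (β γ : ℂ) : V2 →ₗ[ℂ] V2 →ₗ[ℂ] V2 :=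
  bil ![![β • e1, γ • e2], ![β • e2, 0]]

/-- The second multiplication of `C34^{α,β}`:
`e1∗e1 = α e1, e1∗e2 = α e2, e2∗e1 = α e2, e2∗e2 = e1 + β e2`. -/
noncomputable def C34s (α β : ℂ) : V2 →ₗ[ℂ] V2 →ₗ[ℂ] V2 :=
  bil ![![α • e1, α • e2], ![α • e2, e1 + β • e2]]

/-- The second multiplication of `C35^α`:
`e1∗e1 = α e1, e1∗e2 = α e2, e2∗e1 = α e2, e2∗e2 = e2`. -/
noncomputable def C35s (α : ℂ) : V2 →ₗ[ℂ] V2 →ₗ[ℂ] V2 :=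
  bil ![![α • e1, α • e2], ![α • e2, e2]]

/-- The second multiplication of `C38^{α,β,γ}`:
`e1∗e1 = (γ+β−α) e1 − β e2, e1∗e2 = α e1 + β e2, e2∗e1 = α e1 + β e2, e2∗e2 = −α e1 + γ e2`. -/
noncomputable def C38s (α β γ : ℂ) : V2 →ₗ[ℂ] V2 →ₗ[ℂ] V2 :=
  bil ![![(γ + β - α) • e1 - β • e2, α • e1 + β • e2],
        ![α • e1 + β • e2, (-α) • e1 + γ • e2]]

/-- The second multiplication of `C39^{α,β}`: `e1∗e1 = α e1, e2∗e2 = β e2`. -/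
noncomputable def C39s (α β : ℂ) : V2 →ₗ[ℂ] V2 →ₗ[ℂ] V2 :=
  bil ![![α • e1, 0], ![0, β • e2]]

/-- The second multiplication of `C40^{α,β,γ}`:
`e1∗e1 = α e1 + β e2, e1∗e2 = 2α e2, e2∗e1 = γ e1 + α e2, e2∗e2 = 2γ e2`. -/
noncomputable def C40s (α β γ : ℂ) : V2 →ₗ[ℂ] V2 →ₗ[ℂ] V2 :=
  bil ![![α • e1 + β • e2, (2 * α) • e2], ![γ • e1 + α • e2, (2 * γ) • e2]]

/-- The second multiplication of `C41^{α,β}`: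
`e1∗e1 = α e1, e1∗e2 = β e1 + 2α e2, e2∗e1 = (2β + α/2) e1 + α e2,
e2∗e2 = (β/2) e1 + (α+β) e2`. -/
noncomputable def C41s (α β : ℂ) : V2 →ₗ[ℂ] V2 →ₗ[ℂ] V2 :=
  bil ![![α • e1, β • e1 + (2 * α) • e2],
        ![(2 * β + α / 2) • e1 + α • e2, (β / 2) • e1 + (α + β) • e2]]

theorem bil_apply (f : Fin 2 → Fin 2 → V2) (x y : V2) :
    bil f x y = (x 0 * y 0) • f 0 0 + (x 0 * y 1) • f 0 1 +
      ((x 1 * y 0) • f 1 0 + (x 1 * y 1) • f 1 1) := by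
  simp [bil, Fin.sum_univ_two]

/-- The multiplication `e1·e1 = a e1 + b e2, e1·e2 = c e1 + d e2, e2·e1 = p e1 + q e2,
e2·e2 = r e1 + s e2`. -/
noncomputable def bilOfCoeffs (a b c d p q r s : ℂ) : V2 →ₗ[ℂ] V2 →ₗ[ℂ] V2 :=
  bil ![![![a, b], ![c, d]], ![![p, q], ![r, s]]]

theorem eq_bilOfCoeffs (ν : V2 →ₗ[ℂ] V2 →ₗ[ℂ] V2) :
    ν = bilOfCoeffs (ν e1 e1 0) (ν e1 e1 1) (ν e1 e2 0) (ν e1 e2 1)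
      (ν e2 e1 0) (ν e2 e1 1) (ν e2 e2 0) (ν e2 e2 1) := by
  have decomp (x : V2) : x = x 0 • e1 + x 1 • e2 := by
    ext i; fin_cases i <;> simp [e1, e2]
  refine LinearMap.ext₂ fun x y => ?_
  conv_lhs => rw [decomp x, decomp y]
  ext i
  fin_cases i <;> simp [bilOfCoeffs, bil_apply] <;> ring

theorem relations_of_isCompatPreLie_C03 {a b c d p q r s : ℂ}
    (h : IsCompatPreLie C03 (bilOfCoeffs a b c d p q r s)) :
    r = 0 ∧ s = 2 * p - c ∧ q * (q - a) = 0 ∧ (c - p) * a + p * d - q * c - q * p = 0 ∧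
      c * (c - p) = 0 ∧ p * d = 2 * q * (p - c) := by
  obtain ⟨-, hν, hsum⟩ := h
  have n1 := hν e1 e2 e1
  have n2 := hν e1 e2 e2
  have s1 := hsum e1 e2 e1
  simp only [funext_iff, Fin.forall_fin_two] at n1 n2 s1
  simp [C03, bilOfCoeffs, bil_apply, e1, e2] at n1 n2 s1
  obtain ⟨n10, n11⟩ := n1
  obtain ⟨n20, n21⟩ := n2
  obtain ⟨s10, s11⟩ := s1
  obtain rfl : r = 0 := by linear_combination s10 - n10
  obtain rfl : s = 2 * p - c := by linear_combination s11 - n11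
  refine ⟨rfl, rfl, ?_, ?_, ?_, ?_⟩
  · linear_combination -n11
  · linear_combination n10
  · linear_combination n20 / 2
  · linear_combination n21

/-- The linear automorphism `e1 ↦ t e1 + u e2, e2 ↦ t² e2`, which preserves `C03`. -/
noncomputable def shear (t u : ℂ) (ht : t ≠ 0) : V2 ≃ₗ[ℂ] V2 where
  toFun x := ![t * x 0, u * x 0 + t ^ 2 * x 1]
  invFun x := ![x 0 / t, (x 1 - u * (x 0 / t)) / t ^ 2]
  map_add' x y := by ext i; fin_cases i <;> simp <;> ring
  map_smul' k x := by ext i; fin_cases i <;> simp <;> ring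
  left_inv x := by ext i; fin_cases i <;> simp [ht]
  right_inv x := by ext i; fin_cases i <;> simp [field]

theorem shear_apply (t u : ℂ) (ht : t ≠ 0) (x : V2) :
    shear t u ht x = ![t * x 0, u * x 0 + t ^ 2 * x 1] := rfl

theorem compatIso_C03_of_shear {ν ν' : V2 →ₗ[ℂ] V2 →ₗ[ℂ] V2} (t u : ℂ) (ht : t ≠ 0)
    (h : ∀ x y, ν (shear t u ht x) (shear t u ht y) = shear t u ht (ν' x y)) :
    CompatIso C03 ν C03 ν' := by
  have hC (x y : V2) :
      C03 (shear t u ht x) (shear t u ht y) = shear t u ht (C03 x y) := by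
    ext i
    fin_cases i <;> simp [C03, bil_apply, shear_apply, e2]
    ring
  refine ⟨(shear t u ht).symm, fun x y => ?_, fun x y => ?_⟩
  · simpa using congrArg (shear t u ht).symm
      (hC ((shear t u ht).symm x) ((shear t u ht).symm y))
  · simpa using congrArg (shear t u ht).symm
      (h ((shear t u ht).symm x) ((shear t u ht).symm y))

/-- Transport of structure constants along `shear t u`, when `e2·e2` has no `e1`-component. -/
theorem compatIso_C03_bilOfCoeffs {a b c d p q s a' b' c' d' p' q' s' : ℂ}
    (t u : ℂ) (ht : t ≠ 0)
    (ha : t * a + u * (c + p) = a')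
    (hb : t ^ 2 * b + t * u * (d + q) + u ^ 2 * s = u * a' + t ^ 2 * b')
    (hc : t ^ 2 * c = c') (hd : t ^ 3 * d + t ^ 2 * u * s = u * c' + t ^ 2 * d')
    (hp : t ^ 2 * p = p') (hq : t ^ 3 * q + t ^ 2 * u * s = u * p' + t ^ 2 * q')
    (hs : t ^ 2 * s = s') :
    CompatIso C03 (bilOfCoeffs a b c d p q 0 s) C03 (bilOfCoeffs a' b' c' d' p' q' 0 s') := by
  refine compatIso_C03_of_shear t u ht fun x y => ?_
  ext i
  fin_cases i <;> simp [bilOfCoeffs, bil_apply, shear_apply]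
  · linear_combination t * x 0 * y 0 * ha + t * x 0 * y 1 * hc + t * x 1 * y 0 * hp
  · linear_combination x 0 * y 0 * hb + x 0 * y 1 * hd + x 1 * y 0 * hq +
      t ^ 2 * x 1 * y 1 * hs

theorem C13s_eq (α : ℂ) : C13s α = bilOfCoeffs α 0 0 1 0 α 0 0 := by
  rw [eq_bilOfCoeffs (C13s α)]; simp [C13s, bil_apply, e1, e2]

theorem C14s_eq (α : ℂ) : C14s α = bilOfCoeffs 1 α 0 0 0 1 0 0 := by
  rw [eq_bilOfCoeffs (C14s α)]; simp [C14s, bil_apply, e1, e2]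

theorem C15s_eq (α : ℂ) : C15s α = bilOfCoeffs 0 α 0 0 0 0 0 0 := by
  rw [eq_bilOfCoeffs (C15s α)]; simp [C15s, bil_apply, e1, e2]

theorem C16s_eq (α : ℂ) : C16s α = bilOfCoeffs 1 0 0 α 0 0 0 0 := by
  rw [eq_bilOfCoeffs (C16s α)]; simp [C16s, bil_apply, e1, e2]

theorem C17s_eq (α : ℂ) : C17s α = bilOfCoeffs 1 α 0 1 0 0 0 0 := by
  rw [eq_bilOfCoeffs (C17s α)]; simp [C17s, bil_apply, e1, e2]

theorem C18s_eq (α : ℂ) : C18s α = bilOfCoeffs 0 α 1 0 1 0 0 1 := by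
  rw [eq_bilOfCoeffs (C18s α)]; simp [C18s, bil_apply, e1, e2]

theorem C19s_eq (α : ℂ) : C19s α = bilOfCoeffs 0 α 0 0 1 0 0 2 := by
  rw [eq_bilOfCoeffs (C19s α)]; simp [C19s, bil_apply, e1, e2]

theorem exists_sq_mul_eq_one {z : ℂ} (hz : z ≠ 0) : ∃ t : ℂ, t ≠ 0 ∧ t ^ 2 * z = 1 := by
  obtain ⟨t, ht⟩ := IsAlgClosed.exists_pow_nat_eq z⁻¹ (n := 2) two_pos
  refine ⟨t, ?_, by rw [ht, inv_mul_cancel₀ hz]⟩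
  rintro rfl
  simp [eq_comm, hz] at ht

/-- Every compatible pre-Lie algebra whose first multiplication is `C03`
(`e1·e1 = e2`) is isomorphic to some `C13^α`, `C14^α`, `C15^α`, `C16^α`, `C17^α`,
`C18^α` or `C19^α`. -/
theorem compatible_preLie_on_C03 (ν : V2 →ₗ[ℂ] V2 →ₗ[ℂ] V2)
    (h : IsCompatPreLie C03 ν) :
    (∃ α : ℂ, CompatIso C03 ν C03 (C13s α)) ∨
      (∃ α : ℂ, CompatIso C03 ν C03 (C14s α)) ∨
      (∃ α : ℂ, CompatIso C03 ν C03 (C15s α)) ∨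
      (∃ α : ℂ, CompatIso C03 ν C03 (C16s α)) ∨
      (∃ α : ℂ, CompatIso C03 ν C03 (C17s α)) ∨
      (∃ α : ℂ, CompatIso C03 ν C03 (C18s α)) ∨
      (∃ α : ℂ, CompatIso C03 ν C03 (C19s α)) := by
  simp only [C13s_eq, C14s_eq, C15s_eq, C16s_eq, C17s_eq, C18s_eq, C19s_eq]
  rw [eq_bilOfCoeffs ν] at h ⊢
  generalize ν e1 e1 0 = a, ν e1 e1 1 = b, ν e1 e2 0 = c, ν e1 e2 1 = d,
    ν e2 e1 0 = p, ν e2 e1 1 = q, ν e2 e2 0 = r, ν e2 e2 1 = s at h ⊢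
  obtain ⟨rfl, rfl, hqa, hac, hcp, hpd⟩ := relations_of_isCompatPreLie_C03 h
  by_cases hc : c = 0
  · subst hc
    by_cases hp : p = 0
    · subst hp
      by_cases ha : a = 0
      · subst ha
        obtain rfl : q = 0 := by simpa using hqa
        by_cases hd : d = 0
        · subst hd
          right; right; left
          exact ⟨b, compatIso_C03_bilOfCoeffs 1 0 one_ne_zero
            (by ring) (by ring) (by ring) (by ring) (by ring) (by ring) (by ring)⟩
        · left
          exact ⟨0, compatIso_C03_bilOfCoeffs d⁻¹ (-b / d ^ 2) (inv_ne_zero hd)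
            (by ring) (by field_simp; ring) (by ring) (by field_simp; ring) (by ring)
            (by ring) (by ring)⟩
      · rcases mul_eq_zero.mp hqa with rfl | hq
        · by_cases hd : d = a
          · subst hd
            right; right; right; right; left
            exact ⟨b, compatIso_C03_bilOfCoeffs d⁻¹ 0 (inv_ne_zero ha)
              (by field_simp; ring) (by ring) (by ring) (by field_simp; ring) (by ring)
              (by ring) (by ring)⟩
          · have hda : d - a ≠ 0 := sub_ne_zero.mpr hd
            right; right; right; left
            exact ⟨d / a, compatIso_C03_bilOfCoeffs a⁻¹ (-b / (a * (d - a))) (inv_ne_zero ha)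
              (by field_simp; ring) (by field_simp; ring) (by ring) (by field_simp; ring)
              (by ring) (by ring) (by ring)⟩
        · obtain rfl : q = a := sub_eq_zero.mp hq
          by_cases hd : d = 0
          · subst hd
            right; left
            exact ⟨b, compatIso_C03_bilOfCoeffs q⁻¹ 0 (inv_ne_zero ha)
              (by field_simp; ring) (by ring) (by ring) (by ring) (by ring)
              (by field_simp; ring) (by ring)⟩
          · left
            exact ⟨q / d, compatIso_C03_bilOfCoeffs d⁻¹ (-b / d ^ 2) (inv_ne_zero hd)
              (by field_simp; ring) (by field_simp; ring) (by ring) (by field_simp; ring)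
              (by ring) (by field_simp; ring) (by ring)⟩
    · have hd : d = 2 * q := mul_left_cancel₀ hp (by linear_combination hpd)
      subst hd
      obtain rfl : q = a := mul_left_cancel₀ hp (by linear_combination hac)
      obtain ⟨t, ht, htp⟩ := exists_sq_mul_eq_one hp
      have hu : p * (-t * q / p) = -t * q := by field_simp
      generalize -t * q / p = u at hu
      right; right; right; right; right; right
      exact ⟨(t ^ 2 * b + 3 * t * u * q + 2 * u ^ 2 * p) / t ^ 2,
        compatIso_C03_bilOfCoeffs t u ht
        (by linear_combination hu) (by field_simp; ring) (by ring)
        (by linear_combination 2 * t ^ 2 * hu) (by linear_combination htp)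
        (by linear_combination t ^ 2 * hu + u * htp)
        (by linear_combination 2 * htp)⟩
  · obtain rfl : c = p := sub_eq_zero.mp ((mul_eq_zero.mp hcp).resolve_left hc)
    obtain rfl : d = 0 := by simpa [hc] using hpd
    obtain rfl : q = 0 := mul_left_cancel₀ hc (by linear_combination -hac / 2)
    obtain ⟨t, ht, htc⟩ := exists_sq_mul_eq_one hc
    have hu : c * (-t * a / (2 * c)) = -t * a / 2 := by field_simp
    generalize -t * a / (2 * c) = u at hu
    right; right; right; right; right; left
    exact ⟨(t ^ 2 * b + u ^ 2 * c) / t ^ 2, compatIso_C03_bilOfCoeffs t u ht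
      (by linear_combination 2 * hu) (by field_simp; ring) htc
      (by linear_combination u * htc) htc (by linear_combination u * htc)
      (by linear_combination htc)⟩
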